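/- Fix an integer ν ≥ 3. Summing the quantity max_α k_α − min_α k_α over all ν-tuples (k_1,…,k_ν) of even integers satisfying k_1 + ⋯ + k_ν = 0 and 0 < max_α k_α − min_α k_α ≤ 2(ν−1) yields exactly 2(ν−1)·ν^{ν−1} − 2(ν−1)^ν − 2(ν−1)·(−1)^ν. -/

import Mathlib

/-- `max_α k_α − min_α k_α` for a tuple `k : Fin ν → ℤ` (with `ν > 0`). -/
def spread (ν : ℕ) (h : 0 < ν) (k : Fin ν → ℤ) : ℤ :=
  Finset.univ.sup' ⟨⟨0, h⟩, Finset.mem_univ _⟩ k -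
    Finset.univ.inf' ⟨⟨0, h⟩, Finset.mem_univ _⟩ k

open Finset

section ZeroSums

variable {G : Type*} [AddCommGroup G] [DecidableEq G]

/-- Among tuples with entries in `S`, those summing to zero correspond, by forgetting the first
entry, to the shorter tuples whose sum is the negative of an element of `S`. -/
lemma card_zeroSum_succ (S : Finset G) (m : ℕ) :
    #{f ∈ Fintype.piFinset (fun _ : Fin (m + 1) => S) | ∑ i, f i = 0} =
      #{f ∈ Fintype.piFinset (fun _ : Fin m => S) | -∑ i, f i ∈ S} := by
  refine card_nbij' (fun f => Fin.tail f)
    (fun f => Fin.cons (-∑ i, f i) f) ?_ ?_ ?_ ?_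
  · intro f hf
    simp only [coe_filter, Fintype.mem_piFinset, Set.mem_ofPred_eq, Fin.sum_univ_succ] at hf ⊢
    refine ⟨fun i => hf.1 i.succ, ?_⟩
    have h : -∑ i, Fin.tail f i = f 0 := by
      rw [neg_eq_iff_add_eq_zero, add_comm]
      exact hf.2
    rw [h]
    exact hf.1 0
  · intro f hf
    simp only [coe_filter, Fintype.mem_piFinset, Set.mem_ofPred_eq, Fin.sum_univ_succ] at hf ⊢
    refine ⟨fun i => ?_, by simp⟩
    refine Fin.cases ?_ (fun j => ?_) i
    · simpa using hf.2
    · simpa using hf.1 j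
  · intro f hf
    simp only [coe_filter, Fintype.mem_piFinset, Set.mem_ofPred_eq, Fin.sum_univ_succ] at hf
    have h : -∑ i, Fin.tail f i = f 0 := by
      rw [neg_eq_iff_add_eq_zero, add_comm]
      exact hf.2
    simp only [h, Fin.cons_self_tail]
  · intro f _
    simp

lemma card_zeroSum_univ [Fintype G] (m : ℕ) :
    #{f ∈ Fintype.piFinset (fun _ : Fin (m + 1) => (univ : Finset G)) | ∑ i, f i = 0} =
      Fintype.card G ^ m := by
  rw [card_zeroSum_succ]
  simp

lemma card_zeroSum_nonzero [Fintype G] (m : ℕ) :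
    (Fintype.card G : ℤ) *
        #{f ∈ Fintype.piFinset (fun _ : Fin m => (univ.erase 0 : Finset G)) | ∑ i, f i = 0} =
      ((Fintype.card G : ℤ) - 1) ^ m + ((Fintype.card G : ℤ) - 1) * (-1) ^ m := by
  induction m with
  | zero => simp
  | succ m ih =>
    have h := card_filter_add_card_filter_not
      (s := Fintype.piFinset (fun _ : Fin m => (univ.erase 0 : Finset G)))
      (fun f => ∑ i, f i = 0)
    have hpos : 1 ≤ Fintype.card G := Fintype.card_pos
    rw [Fintype.card_piFinset_const, card_erase_of_mem (mem_univ _), card_univ] at h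
    have h' := congrArg (Nat.cast : ℕ → ℤ) h
    push_cast [Nat.cast_sub hpos] at h'
    rw [card_zeroSum_succ]
    simp only [mem_erase, mem_univ, and_true, ne_eq, neg_eq_zero]
    rw [pow_succ, pow_succ]
    linear_combination (Fintype.card G : ℤ) * h' - ih

end ZeroSums

/-- The tuples with entries in `{0, …, w - 1}` whose sum is divisible by their length. -/
noncomputable def divisibleTuples (ν w : ℕ) : Finset (Fin ν → ℤ) :=
  {n ∈ Fintype.piFinset (fun _ : Fin ν => Ico (0 : ℤ) w) | (ν : ℤ) ∣ ∑ i, n i}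

lemma mem_divisibleTuples {ν w : ℕ} {n : Fin ν → ℤ} :
    n ∈ divisibleTuples ν w ↔ (∀ i, 0 ≤ n i ∧ n i < w) ∧ (ν : ℤ) ∣ ∑ i, n i := by
  simp [divisibleTuples]

/-- Reducing the entries modulo `ν` after adding one turns divisibility of the sum into a
zero-sum condition in `ZMod ν`. -/
lemma card_divisibleTuples {ν w : ℕ} (hw : w ≤ ν) :
    #(divisibleTuples ν w) =
      #{f ∈ Fintype.piFinset (fun _ : Fin ν =>
          (Ico (0 : ℤ) w).image (fun x : ℤ => (x + 1 : ZMod ν))) | ∑ i, f i = 0} := by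
  rw [Fintype.piFinset_image, filter_image, card_image_of_injOn]
  · congr 1
    refine filter_congr fun n _ => ?_
    simp [sum_add_distrib, ← ZMod.intCast_zmod_eq_zero_iff_dvd]
  · intro n hn n' hn' h
    simp only [coe_filter, Fintype.mem_piFinset, mem_Ico, Set.mem_ofPred_eq] at hn hn'
    funext i
    have hi := congrFun h i
    simp only [add_left_inj] at hi
    rw [ZMod.intCast_eq_intCast_iff] at hi
    have h1 := hn.1 i
    have h2 := hn'.1 i
    rwa [Int.ModEq, Int.emod_eq_of_lt h1.1 (by omega),
      Int.emod_eq_of_lt h2.1 (by omega)] at hi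

lemma card_divisibleTuples_self {ν : ℕ} (hν : 0 < ν) :
    #(divisibleTuples ν ν) = ν ^ (ν - 1) := by
  have : NeZero ν := ⟨hν.ne'⟩
  rw [card_divisibleTuples le_rfl]
  have h : (Ico (0 : ℤ) ν).image (fun x : ℤ => (x + 1 : ZMod ν)) = univ := by
    refine eq_univ_of_forall fun a => mem_image.2 ⟨((a - 1).val : ℤ), ?_, by simp⟩
    have := (a - 1).val_lt
    simp only [mem_Ico]
    omega
  rw [h]
  have h' := card_zeroSum_univ (G := ZMod ν) (ν - 1)
  rwa [Nat.sub_add_cancel hν, ZMod.card] at h'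

lemma card_divisibleTuples_pred {ν : ℕ} (hν : 0 < ν) :
    (ν : ℤ) * #(divisibleTuples ν (ν - 1)) = ((ν : ℤ) - 1) ^ ν + ((ν : ℤ) - 1) * (-1) ^ ν := by
  have : NeZero ν := ⟨hν.ne'⟩
  rw [card_divisibleTuples (Nat.sub_le _ _)]
  have h : (Ico (0 : ℤ) (ν - 1 : ℕ)).image (fun x : ℤ => (x + 1 : ZMod ν)) = univ.erase 0 := by
    ext a
    simp only [mem_image, mem_Ico, mem_erase, mem_univ, and_true]
    constructor
    · rintro ⟨x, hx, rfl⟩ h0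
      have h0' : ((x + 1 : ℤ) : ZMod ν) = 0 := by exact_mod_cast h0
      rw [ZMod.intCast_zmod_eq_zero_iff_dvd] at h0'
      have := Int.le_of_dvd (by omega) h0'
      omega
    · intro ha
      have h1 := a.val_lt
      have h2 : a.val ≠ 0 := by simpa using ha
      exact ⟨(a.val : ℤ) - 1, by omega, by simp⟩
  rw [h]
  simpa using card_zeroSum_nonzero (G := ZMod ν) ν

section Spread

variable {ν : ℕ} {h : 0 < ν}

lemma spread_nonneg (k : Fin ν → ℤ) : 0 ≤ spread ν h k :=
  sub_nonneg.2 ((inf'_le k (mem_univ ⟨0, h⟩)).trans (le_sup' k (mem_univ _)))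

lemma spread_two_mul (k : Fin ν → ℤ) : spread ν h (fun i => 2 * k i) = 2 * spread ν h k := by
  have hmono : Monotone (fun x : ℤ => 2 * x) := fun a b hab => by dsimp only; omega
  have hsup := Finset.apply_sup'_eq_sup'_comp (f := k) ⟨⟨0, h⟩, mem_univ _⟩
    (fun x : ℤ => 2 * x) (fun a b => hmono.map_sup a b)
  have hinf := Finset.apply_inf'_eq_inf'_comp (f := k) ⟨⟨0, h⟩, mem_univ _⟩
    (fun x : ℤ => 2 * x) (fun a b => hmono.map_inf a b)
  simp only [Function.comp_def] at hsup hinf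
  rw [spread, ← hsup, ← hinf, spread, mul_sub]

/-- The shifts of `k` whose entries all lie in `{0, …, w - 1}`. -/
lemma forall_shift_mem_iff (k : Fin ν → ℤ) (w t : ℤ) :
    (∀ i, 0 ≤ k i + t ∧ k i + t < w) ↔
      t ∈ Ico (-univ.inf' ⟨⟨0, h⟩, mem_univ _⟩ k) (w - univ.sup' ⟨⟨0, h⟩, mem_univ _⟩ k) := by
  have hinf := le_inf'_iff (a := -t) ⟨⟨0, h⟩, mem_univ _⟩ k
  have hsup := sup'_lt_iff (f := k) (a := w - t) ⟨⟨0, h⟩, mem_univ _⟩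
  rw [mem_Ico, neg_le, hinf, lt_sub_comm, hsup]
  simp only [mem_univ, forall_true_left, forall_and]
  exact and_congr (forall_congr' fun i => by omega) (forall_congr' fun i => by omega)

end Spread

/-- Subtract from a tuple the (rounded) mean of its entries. -/
def center {ν : ℕ} (n : Fin ν → ℤ) : Fin ν → ℤ := fun i => n i - (∑ j, n j) / ν

lemma sum_center {ν : ℕ} {n : Fin ν → ℤ} (hn : (ν : ℤ) ∣ ∑ i, n i) : ∑ i, center n i = 0 := by
  simp [center, Int.mul_ediv_cancel' hn]

lemma center_add_const {ν : ℕ} (hν : 0 < ν) {m : Fin ν → ℤ} (hm : ∑ i, m i = 0) (t : ℤ) :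
    center (fun i => m i + t) = m := by
  have : (ν : ℤ) ≠ 0 := by omega
  funext i
  simp [center, sum_add_distrib, hm, Int.mul_ediv_cancel_left _ this]

/-- The tuples of integers with zero sum and spread less than their length. -/
noncomputable def centeredTuples (ν : ℕ) : Finset (Fin ν → ℤ) := (divisibleTuples ν ν).image center

/-- The divisible tuples with center `m` are the shifts of `m` that fit into the window. -/
lemma filter_center_eq {ν w : ℕ} (h : 0 < ν) {m : Fin ν → ℤ} (hm : ∑ i, m i = 0) :
    {n ∈ divisibleTuples ν w | center n = m} =
      (Ico (-univ.inf' ⟨⟨0, h⟩, mem_univ _⟩ m) (w - univ.sup' ⟨⟨0, h⟩, mem_univ _⟩ m)).image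
        (fun t i => m i + t) := by
  ext n
  simp only [mem_filter, mem_image, mem_divisibleTuples, ← forall_shift_mem_iff (h := h)]
  constructor
  · rintro ⟨⟨hn, -⟩, rfl⟩
    exact ⟨(∑ j, n j) / ν, by simpa [center] using hn, by simp [center]⟩
  · rintro ⟨t, ht, rfl⟩
    exact ⟨⟨ht, by simp [sum_add_distrib, hm]⟩, center_add_const h hm t⟩

lemma card_filter_center {ν w : ℕ} (h : 0 < ν) {m : Fin ν → ℤ} (hm : ∑ i, m i = 0) :
    #{n ∈ divisibleTuples ν w | center n = m} = ((w : ℤ) - spread ν h m).toNat := by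
  rw [filter_center_eq h hm, card_image_of_injective, Int.card_Ico, spread]
  · congr 1
    ring
  · intro t t' ht
    simpa using congrFun ht ⟨0, h⟩

lemma mem_centeredTuples {ν : ℕ} (h : 0 < ν) {m : Fin ν → ℤ} :
    m ∈ centeredTuples ν ↔ ∑ i, m i = 0 ∧ spread ν h m ≤ ν - 1 := by
  have key (hm : ∑ i, m i = 0) : m ∈ centeredTuples ν ↔ spread ν h m ≤ ν - 1 := by
    rw [centeredTuples, ← fiber_nonempty_iff_mem_image, ← card_pos, card_filter_center h hm]
    omega
  refine ⟨fun hmem => ?_, fun hm => (key hm.1).2 hm.2⟩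
  obtain ⟨n, hn, rfl⟩ := mem_image.1 hmem
  have h0 := sum_center (mem_divisibleTuples.1 hn).2
  exact ⟨h0, (key h0).1 hmem⟩

/-- Counting divisible tuples by their centers. -/
lemma card_divisibleTuples_eq_sum {ν w : ℕ} (h : 0 < ν) (hw : w ≤ ν) (hw' : ν ≤ w + 1) :
    (#(divisibleTuples ν w) : ℤ) = ∑ m ∈ centeredTuples ν, (w - spread ν h m) := by
  rw [card_eq_sum_card_fiberwise (f := center) (t := centeredTuples ν), Nat.cast_sum]
  · refine sum_congr rfl fun m hm => ?_
    rw [mem_centeredTuples h] at hm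
    rw [card_filter_center h hm.1]
    omega
  · intro n hn
    refine mem_image_of_mem _ ?_
    rw [mem_coe, mem_divisibleTuples] at hn
    exact mem_divisibleTuples.2 ⟨fun i => by have := hn.1 i; omega, hn.2⟩

lemma sum_spread_centeredTuples {ν : ℕ} (h : 0 < ν) :
    ∑ m ∈ centeredTuples ν, spread ν h m =
      ((ν : ℤ) - 1) * (ν : ℤ) ^ (ν - 1) - ((ν : ℤ) - 1) ^ ν - ((ν : ℤ) - 1) * (-1) ^ ν := by
  have h1 := card_divisibleTuples_eq_sum h le_rfl (Nat.le_succ ν)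
  have h2 := card_divisibleTuples_eq_sum (w := ν - 1) h (Nat.sub_le _ _) (by omega)
  have h3 := card_divisibleTuples_pred h
  rw [card_divisibleTuples_self h] at h1
  simp only [sum_sub_distrib, sum_const, nsmul_eq_mul] at h1 h2
  push_cast [Nat.cast_sub (show 1 ≤ ν from h)] at h1 h2
  linear_combination (-(ν : ℤ) + 1) * h1 + (ν : ℤ) * h2 - h3

theorem sum_of_spreads_of_even_tuples
    (ν : ℕ) (hν : 3 ≤ ν) :
    (∑ᶠ k ∈ {k : Fin ν → ℤ | (∀ α, Even (k α)) ∧ (∑ α, k α) = 0 ∧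
        0 < spread ν (by omega) k ∧ spread ν (by omega) k ≤ 2 * ((ν : ℤ) - 1)},
      spread ν (by omega) k)
      = 2 * ((ν : ℤ) - 1) * (ν : ℤ) ^ (ν - 1) - 2 * ((ν : ℤ) - 1) ^ ν
          - 2 * ((ν : ℤ) - 1) * (-1) ^ ν := by
  have h : 0 < ν := by omega
  have hset : {k : Fin ν → ℤ | (∀ α, Even (k α)) ∧ (∑ α, k α) = 0 ∧
        0 < spread ν h k ∧ spread ν h k ≤ 2 * ((ν : ℤ) - 1)} =
      (({m ∈ centeredTuples ν | spread ν h m ≠ 0}.image fun m i => 2 * m i :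
        Finset (Fin ν → ℤ)) : Set (Fin ν → ℤ)) := by
    ext k
    simp only [Set.mem_ofPred_eq, coe_image, Set.mem_image, mem_coe, mem_filter,
      mem_centeredTuples h]
    constructor
    · rintro ⟨heven, hsum, hpos, hle⟩
      choose m hm using fun i => (heven i).two_dvd
      obtain rfl : k = fun i => 2 * m i := funext hm
      rw [spread_two_mul] at hpos hle
      rw [← mul_sum] at hsum
      exact ⟨m, ⟨⟨by omega, by omega⟩, by omega⟩, rfl⟩
    · rintro ⟨m, ⟨⟨hsum, hle⟩, hne⟩, rfl⟩
      have := spread_nonneg (h := h) m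
      rw [spread_two_mul, ← mul_sum, hsum]
      exact ⟨fun i => even_two_mul _, mul_zero _, by omega, by omega⟩
  have hinj : Function.Injective fun (m : Fin ν → ℤ) i => 2 * m i := by
    intro m m' hm
    funext i
    simpa using congrFun hm i
  rw [hset, finsum_mem_coe_finset, sum_image hinj.injOn]
  simp only [spread_two_mul]
  rw [← mul_sum, sum_filter_ne_zero, sum_spread_centeredTuples h]
  ring
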